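/- Second order accuracy of the corrected slow equation (Lemma 2). For every M > 0 and T₀ > 0 there exist C > 0 and ε₀ > 0, depending only on l, A, X, Λ, g, c, δ, M and T₀, such that the following holds for every ε ∈ (0, ε₀]. Let (U, B) be a bounded C² solution of the system on ℝ × [0, T₀/ε] with all partial derivatives up to order two bounded by M, let B₀ = B(·,0) and B^{(0)}(x,t) = B₀(x − λ_B^{(0)} ε t). Let U^{(1)} : ℝ × [0, T₀/ε] → ℝˡ be a bounded C¹ solution, with first derivatives bounded by M, of U^{(1)}_t + A U^{(1)}_x = −g ∂_x B^{(0)}(x,t), and let B̂^{(1)} be a C¹ solution of B̂^{(1)}_t − ε cᵀ A⁻¹ g B̂^{(1)}_x − ε cᵀ A⁻¹ U^{(1)}_t = 0 with B̂^{(1)}(·,0) = B₀. Suppose in addition: (1) sup_x |(A + ε X⁻¹ Λ X̂) U_x(x,0) + (g + ε X⁻¹ Λ α̂) B_x(x,0)| ≤ M ε²; (2) sup_x |A U_{xx}(x,0) + g B_{xx}(x,0)| ≤ M ε; (3) sup_x |(1+ε) A U^{(1)}_x(x,0) + ((1+ε) g − ε A⁻¹ g cᵀ A⁻¹ g) ∂_x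 B^{(0)}(x,0)| ≤ M ε²; (4) B₀ ∈ W^{2,∞}(ℝ) with ‖B₀‖_{W^{2,∞}} ≤ M. Then sup_{x∈ℝ, 0 ≤ t ≤ T₀/ε} |B(x,t) − B̂^{(1)}(x,t)| ≤ C ε². -/

import Mathlib

open Matrix Set

theorem aux_chain {T : ℝ} (hT : 0 < T) (F Fx Ft : ℝ → ℝ → ℝ)
    (hd : DifferentiableOn ℝ (fun p : ℝ × ℝ => F p.1 p.2) (univ ×ˢ Icc (0:ℝ) T))
    (hx : ∀ x, ∀ t ∈ Icc (0:ℝ) T, HasDerivAt (fun x' => F x' t) (Fx x t) x)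
    (ht : ∀ x, ∀ t ∈ Icc (0:ℝ) T, HasDerivWithinAt (fun t' => F x t') (Ft x t) (Icc 0 T) t)
    (s y t : ℝ) (htm : t ∈ Icc (0:ℝ) T) :
    HasDerivWithinAt (fun t' => F (y + s * t') t') (Ft (y + s * t) t + s * Fx (y + s * t) t)
      (Icc 0 T) t := by
  have hL := (hd (y + s * t, t) ⟨mem_univ _, htm⟩).hasFDerivWithinAt
  set L := fderivWithin ℝ (fun p : ℝ × ℝ => F p.1 p.2) (univ ×ˢ Icc (0:ℝ) T) (y + s * t, t)
  have h1 : L (1, 0) = Fx (y + s * t) t := by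
    have hc : HasDerivWithinAt (fun x' : ℝ => (x', t)) ((1:ℝ), (0:ℝ)) univ (y + s * t) :=
      ((hasDerivAt_id _).prodMk (hasDerivAt_const _ _)).hasDerivWithinAt
    have := HasFDerivWithinAt.comp_hasDerivWithinAt (f := fun x' : ℝ => (x', t)) (y + s * t) hL hc
      (fun x' _ => ⟨mem_univ _, htm⟩)
    rw [hasDerivWithinAt_univ] at this
    exact this.unique (hx _ t htm)
  have h2 : L (0, 1) = Ft (y + s * t) t := by
    have hc : HasDerivWithinAt (fun t' : ℝ => (y + s * t, t')) ((0:ℝ), (1:ℝ)) (Icc 0 T) t :=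
      ((hasDerivAt_const _ _).prodMk (hasDerivAt_id _)).hasDerivWithinAt
    have := HasFDerivWithinAt.comp_hasDerivWithinAt (f := fun t' : ℝ => (y + s * t, t')) t hL hc
      (fun x' h => ⟨mem_univ _, h⟩)
    exact (uniqueDiffOn_Icc hT t htm).eq_deriv _ this (ht _ t htm)
  have hc : HasDerivWithinAt (fun t' : ℝ => (y + s * t', t')) (s, (1:ℝ)) (Icc 0 T) t := by
    have h0 : HasDerivAt (fun t' : ℝ => y + s * t') s t := by
      simpa using ((hasDerivAt_id t).const_mul s).const_add y
    exact (h0.prodMk (hasDerivAt_id _)).hasDerivWithinAt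
  have := HasFDerivWithinAt.comp_hasDerivWithinAt (f := fun t' : ℝ => (y + s * t', t')) t hL hc
      (fun x' h => ⟨mem_univ _, h⟩)
  have e : L (s, 1) = Ft (y + s * t) t + s * Fx (y + s * t) t := by
    have : ((s, 1) : ℝ × ℝ) = (0, 1) + s • (1, 0) := by ext <;> simp
    rw [this, map_add, map_smul, h1, h2, smul_eq_mul]
  rw [e] at this
  exact this

theorem aux_transport {T : ℝ} (hT : 0 < T) (F Fx Ft : ℝ → ℝ → ℝ)
    (hd : DifferentiableOn ℝ (fun p : ℝ × ℝ => F p.1 p.2) (univ ×ˢ Icc (0:ℝ) T))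
    (hx : ∀ x, ∀ t ∈ Icc (0:ℝ) T, HasDerivAt (fun x' => F x' t) (Fx x t) x)
    (ht : ∀ x, ∀ t ∈ Icc (0:ℝ) T, HasDerivWithinAt (fun t' => F x t') (Ft x t) (Icc 0 T) t)
    (s K : ℝ) (hK : ∀ x, ∀ t ∈ Icc (0:ℝ) T, |Ft x t + s * Fx x t| ≤ K)
    (x t : ℝ) (htm : t ∈ Icc (0:ℝ) T) :
    |F x t - F (x - s * t) 0| ≤ K * t := by
  have := Convex.norm_image_sub_le_of_norm_hasDerivWithin_le (𝕜 := ℝ)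
    (f := fun t' => F ((x - s * t) + s * t') t')
    (f' := fun t' => Ft ((x - s * t) + s * t') t' + s * Fx ((x - s * t) + s * t') t')
    (C := K) (s := Icc 0 T) (x := 0) (y := t)
    (fun t' h => aux_chain hT F Fx Ft hd hx ht s _ t' h)
    (fun t' h => hK _ t' h) (convex_Icc 0 T) ⟨le_rfl, hT.le⟩ htm
  simpa [abs_of_nonneg htm.1] using this

theorem aux_system {n : Type*} [Fintype n] [DecidableEq n] {T : ℝ} (hT : 0 < T)
    (W Wx Wt : ℝ → ℝ → n → ℝ) (K C : Matrix n n ℝ) (d : n → ℝ)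
    (hKC : K * C = diagonal d * K)
    (hd : DifferentiableOn ℝ (fun p : ℝ × ℝ => W p.1 p.2) (univ ×ˢ Icc (0:ℝ) T))
    (hx : ∀ x, ∀ t ∈ Icc (0:ℝ) T, HasDerivAt (fun x' => W x' t) (Wx x t) x)
    (ht : ∀ x, ∀ t ∈ Icc (0:ℝ) T, HasDerivWithinAt (fun t' => W x t') (Wt x t) (Icc 0 T) t)
    (hpde : ∀ x, ∀ t ∈ Icc (0:ℝ) T, Wt x t = -(C *ᵥ Wx x t)) (i : n) :
    ∀ x, ∀ t ∈ Icc (0:ℝ) T,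
      (K *ᵥ Wt x t) i = - (d i * (K *ᵥ Wx x t) i) ∧
      (K *ᵥ Wx x t) i = (K *ᵥ Wx (x - d i * t) 0) i := by
  have hp : ∀ x, ∀ t ∈ Icc (0:ℝ) T, (K *ᵥ Wt x t) i = - (d i * (K *ᵥ Wx x t) i) := by
    intro x t h
    rw [hpde x t h, mulVec_neg, mulVec_mulVec, hKC, ← mulVec_mulVec, Pi.neg_apply,
      mulVec_diagonal]
  have hx' : ∀ x, ∀ t ∈ Icc (0:ℝ) T,
      HasDerivAt (fun x' => (K *ᵥ W x' t) i) ((K *ᵥ Wx x t) i) x := by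
    intro x t h
    simp only [mulVec, dotProduct]
    exact HasDerivAt.fun_sum fun j _ => ((hasDerivAt_pi.1 (hx x t h)) j).const_mul _
  have ht' : ∀ x, ∀ t ∈ Icc (0:ℝ) T,
      HasDerivWithinAt (fun t' => (K *ᵥ W x t') i) ((K *ᵥ Wt x t) i) (Icc 0 T) t := by
    intro x t h
    simp only [mulVec, dotProduct]
    exact HasDerivWithinAt.fun_sum fun j _ => ((hasDerivWithinAt_pi.1 (ht x t h)) j).const_mul _
  have hd' : DifferentiableOn ℝ (fun p : ℝ × ℝ => (K *ᵥ W p.1 p.2) i)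
      (univ ×ˢ Icc (0:ℝ) T) := by
    simp only [mulVec, dotProduct]
    exact DifferentiableOn.fun_sum fun j _ => ((differentiableOn_pi.1 hd) j).const_mul _
  intro x t h
  refine ⟨hp x t h, ?_⟩
  have key : ∀ x, (K *ᵥ W x t) i = (K *ᵥ W (x - d i * t) 0) i := by
    intro x
    have := aux_transport hT (fun x t => (K *ᵥ W x t) i) _ _ hd' hx' ht' (d i) 0
      (fun x t h => by rw [hp x t h]; simp) x t h
    rw [zero_mul] at this
    exact sub_eq_zero.1 (abs_nonpos_iff.1 this)
  have h0 : HasDerivAt (fun x' => (K *ᵥ W (x' - d i * t) 0) i)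
      ((K *ᵥ Wx (x - d i * t) 0) i) x := by
    have := (hx' (x - d i * t) 0 ⟨le_rfl, hT.le⟩).comp_sub_const x (d i * t)
    exact this
  have h1 := hx' x t h
  rw [show (fun x' => (K *ᵥ W x' t) i) = fun x' => (K *ᵥ W (x' - d i * t) 0) i from
    funext key] at h1
  exact h1.unique h0

theorem aux_dot {l : ℕ} (v w : Fin l → ℝ) (a : ℝ) (ha : ∀ i, |v i| ≤ a) :
    |v ⬝ᵥ w| ≤ l * a * ‖w‖ := by
  unfold dotProduct
  calc |∑ i, v i * w i| ≤ ∑ i, |v i * w i| := Finset.abs_sum_le_sum_abs _ _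
    _ ≤ ∑ i : Fin l, a * ‖w‖ := by
        refine Finset.sum_le_sum fun i _ => ?_
        rw [abs_mul]
        have := ha i
        have h2 := norm_le_pi_norm w i
        rw [Real.norm_eq_abs] at h2
        have := abs_nonneg (v i)
        exact mul_le_mul (ha i) h2 (abs_nonneg _) (by linarith)
    _ = l * a * ‖w‖ := by simp [mul_assoc]

theorem aux_mat {l : ℕ} (K : Matrix (Fin l) (Fin l) ℝ) (w : Fin l → ℝ) (a : ℝ) (h0 : 0 ≤ a)
    (ha : ∀ i j, |K i j| ≤ a) : ‖K *ᵥ w‖ ≤ l * a * ‖w‖ := by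
  rw [pi_norm_le_iff_of_nonneg (by positivity)]
  intro i
  exact aux_dot (K i) w a (ha i)

theorem aux_mat_ex {l : ℕ} (K : Matrix (Fin l) (Fin l) ℝ) :
    ∃ N : ℝ, 0 ≤ N ∧ ∀ w, ‖K *ᵥ w‖ ≤ N * ‖w‖ := by
  refine ⟨l * (∑ i, ∑ j, |K i j|), by positivity, fun w => aux_mat K w _ (by positivity) ?_⟩
  intro i j
  exact (Finset.single_le_sum (f := fun j => |K i j|) (fun _ _ => abs_nonneg _)
    (Finset.mem_univ j)).trans (Finset.single_le_sum (f := fun i => ∑ j, |K i j|)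
      (fun _ _ => by positivity) (Finset.mem_univ i))

theorem aux_dot_ex {l : ℕ} (c : Fin l → ℝ) :
    ∃ N : ℝ, 0 ≤ N ∧ ∀ w, |c ⬝ᵥ w| ≤ N * ‖w‖ :=
  ⟨l * ‖c‖, by positivity, fun w => aux_dot c w _ fun i => norm_le_pi_norm c i⟩

theorem aux_algU {l : ℕ} (A X Y Xi : Matrix (Fin l) (Fin l) ℝ) (g c w : Fin l → ℝ)
    (hXi : Xi * X = 1) (hY : Y * A = 1) (hw : Y *ᵥ g = w) (M C2 : ℝ) (hM : 0 < M)
    (hC2 : 0 ≤ C2) :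
    ∃ C : ℝ, 0 ≤ C ∧ ∀ ε : ℝ, 0 < ε → ε ≤ 1 → ∀ (Xhat : Matrix (Fin l) (Fin l) ℝ)
      (αhat : Fin l → ℝ), (∀ i j, |Xhat i j| ≤ M) → (∀ i, |αhat i| ≤ M) →
      ∀ (ux ut : Fin l → ℝ) (bx bt : ℝ), ‖ux‖ ≤ M → ‖ut‖ ≤ M →
      ut + A *ᵥ ux = -bx • g → bt + ε * (c ⬝ᵥ ux) = 0 →
      ‖(X + ε • Xhat) *ᵥ ut + bt • (X *ᵥ w + ε • αhat)‖ ≤ C2 * ε ^ 2 →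
      ‖ut - (ε * (-(c ⬝ᵥ w)) * bx) • w‖ ≤ C * ε ^ 2 := by
  obtain ⟨NX, hNX, NXb⟩ := aux_mat_ex Xi
  obtain ⟨NY, hNY, NYb⟩ := aux_mat_ex Y
  obtain ⟨Nc, hNc, Ncb⟩ := aux_dot_ex c
  set D1 := NX * (C2 + l * M * M + Nc * M * M) + Nc * M * ‖w‖ with hD1
  have hD1p : 0 ≤ D1 := by positivity
  refine ⟨NX * (C2 + l * M * D1 + Nc * M * M) + Nc * NY * D1 * ‖w‖, by positivity, ?_⟩
  intro ε he he1 Xhat αhat hXh hαh ux ut bx bt hux hut hpde hbt hr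
  set r := (X + ε • Xhat) *ᵥ ut + bt • (X *ᵥ w + ε • αhat) with hrdef
  have hα : ‖αhat‖ ≤ M := (pi_norm_le_iff_of_nonneg hM.le).2 hαh
  have hXu : ‖Xhat *ᵥ ut‖ ≤ l * M * ‖ut‖ := aux_mat Xhat ut M hM.le hXh
  have he_eq : ut + bt • w = Xi *ᵥ (r - ε • (Xhat *ᵥ ut) - (ε * bt) • αhat) := by
    have : r - ε • (Xhat *ᵥ ut) - (ε * bt) • αhat = X *ᵥ (ut + bt • w) := by
      rw [hrdef, add_mulVec, smul_mulVec, mulVec_add, mulVec_smul]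
      ext i
      simp
      ring
    rw [this, mulVec_mulVec, hXi, one_mulVec]
  have hbtb : |bt| ≤ ε * (Nc * M) := by
    have : bt = -(ε * (c ⬝ᵥ ux)) := by linarith
    rw [this, abs_neg, abs_mul, abs_of_pos he]
    have := Ncb ux
    gcongr
    exact this.trans (by gcongr)
  have hebound : ‖ut + bt • w‖ ≤ NX * (C2 * ε ^ 2 + ε * (l * M * ‖ut‖) + ε * (ε * (Nc * M)) * M) := by
    rw [he_eq]
    refine (NXb _).trans ?_
    gcongr
    refine (norm_sub_le _ _).trans ?_
    refine add_le_add ((norm_sub_le _ _).trans (add_le_add hr ?_)) ?_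
    · rw [norm_smul, Real.norm_eq_abs, abs_of_pos he]; gcongr
    · rw [norm_smul, Real.norm_eq_abs, abs_mul, abs_of_pos he]; gcongr
  have hee : ε ^ 2 ≤ ε := by nlinarith
  have hut1 : ‖ut‖ ≤ ε * D1 := by
    have h1 : ‖ut‖ ≤ ‖ut + bt • w‖ + |bt| * ‖w‖ := by
      have : ut = (ut + bt • w) - bt • w := by simp
      calc ‖ut‖ = ‖(ut + bt • w) - bt • w‖ := by rw [← this]
        _ ≤ _ := (norm_sub_le _ _).trans (by rw [norm_smul, Real.norm_eq_abs])
    have h2 : NX * (C2 * ε ^ 2 + ε * (l * M * ‖ut‖) + ε * (ε * (Nc * M)) * M) ≤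
        NX * (C2 * ε + ε * (l * M * M) + ε * (1 * (Nc * M)) * M) := by
      gcongr
    have h3 : |bt| * ‖w‖ ≤ ε * (Nc * M) * ‖w‖ := by gcongr
    rw [hD1]
    calc ‖ut‖ ≤ _ := h1
      _ ≤ NX * (C2 * ε + ε * (l * M * M) + ε * (1 * (Nc * M)) * M) + ε * (Nc * M) * ‖w‖ :=
        add_le_add (hebound.trans h2) h3
      _ = _ := by ring
  have hE : ‖ut + bt • w‖ ≤ NX * (C2 + l * M * D1 + Nc * M * M) * ε ^ 2 := by
    refine hebound.trans ?_
    calc _ ≤ NX * (C2 * ε ^ 2 + ε * (l * M * (ε * D1)) + ε * (ε * (Nc * M)) * M) := by gcongr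
      _ = _ := by ring
  have hux_eq : ux = -bx • w - Y *ᵥ ut := by
    have : A *ᵥ ux = -bx • g - ut := by rw [← hpde]; simp
    calc ux = Y *ᵥ (A *ᵥ ux) := by rw [mulVec_mulVec, hY, one_mulVec]
      _ = _ := by rw [this, mulVec_sub, mulVec_smul, hw]
  have hq : bt + ε * (-(c ⬝ᵥ w)) * bx = ε * (c ⬝ᵥ Y *ᵥ ut) := by
    have : c ⬝ᵥ ux = -bx * (c ⬝ᵥ w) - c ⬝ᵥ Y *ᵥ ut := by
      conv_lhs => rw [hux_eq]
      rw [dotProduct_sub, dotProduct_smul, smul_eq_mul]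
    rw [this] at hbt
    linarith
  have hfin : ut - (ε * (-(c ⬝ᵥ w)) * bx) • w = (ut + bt • w) - (ε * (c ⬝ᵥ Y *ᵥ ut)) • w := by
    rw [← hq]; ext i; simp; ring
  rw [hfin]
  refine (norm_sub_le _ _).trans ?_
  have hlast : ‖(ε * (c ⬝ᵥ Y *ᵥ ut)) • w‖ ≤ Nc * NY * D1 * ‖w‖ * ε ^ 2 := by
    rw [norm_smul, Real.norm_eq_abs, abs_mul, abs_of_pos he]
    calc ε * |c ⬝ᵥ Y *ᵥ ut| * ‖w‖ ≤ ε * (Nc * (NY * (ε * D1))) * ‖w‖ := by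
          gcongr
          refine (Ncb _).trans ?_
          gcongr
          refine (NYb _).trans ?_
          gcongr
      _ = _ := by ring
  calc _ ≤ _ := add_le_add hE hlast
    _ = _ := by ring

theorem aux_algU0 {l : ℕ} (A X L Li : Matrix (Fin l) (Fin l) ℝ) (g w : Fin l → ℝ)
    (hX : IsUnit X) (hA : A = X⁻¹ * L * X) (hL : Li * L = 1)
    (hw : A *ᵥ w = g) (M : ℝ) (hM : 0 < M) :
    ∃ C : ℝ, 0 ≤ C ∧ ∀ ε : ℝ, 0 < ε → ∀ (Xhat : Matrix (Fin l) (Fin l) ℝ)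
      (αhat : Fin l → ℝ) (ux : Fin l → ℝ) (bx : ℝ),
      ‖(A + ε • (X⁻¹ * L * Xhat)) *ᵥ ux + bx • (g + ε • (X⁻¹ * L) *ᵥ αhat)‖ ≤ M * ε ^ 2 →
      ‖(X + ε • Xhat) *ᵥ ux + bx • (X *ᵥ w + ε • αhat)‖ ≤ C * ε ^ 2 := by
  obtain ⟨N, hN, Nb⟩ := aux_mat_ex (Li * X)
  have hXX : X * X⁻¹ = 1 := mul_nonsing_inv X ((isUnit_iff_isUnit_det X).1 hX)
  have h1 : (Li * X) * (X⁻¹ * L) = 1 := by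
    rw [Matrix.mul_assoc, ← Matrix.mul_assoc X, hXX, Matrix.one_mul, hL]
  have h2 : (Li * X) * A = X := by
    rw [hA, ← Matrix.mul_assoc, h1, Matrix.one_mul]
  refine ⟨N * M, by positivity, fun ε he Xhat αhat ux bx h => ?_⟩
  have : (X + ε • Xhat) *ᵥ ux + bx • (X *ᵥ w + ε • αhat) = (Li * X) *ᵥ
      ((A + ε • (X⁻¹ * L * Xhat)) *ᵥ ux + bx • (g + ε • (X⁻¹ * L) *ᵥ αhat)) := by
    rw [← hw]
    simp only [mulVec_add, mulVec_smul, mulVec_mulVec, Matrix.mul_add, mul_smul_comm, h2,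
      ← Matrix.mul_assoc (Li * X) (X⁻¹ * L), h1, Matrix.one_mul, one_mulVec]
  rw [this]
  calc _ ≤ N * (M * ε ^ 2) := (Nb _).trans (by gcongr)
    _ = _ := by ring

theorem aux_alg1 {l : ℕ} (A X Y : Matrix (Fin l) (Fin l) ℝ) (g w : Fin l → ℝ) (m : ℝ)
    (hY : Y * A = 1) (hw : Y *ᵥ g = w) (M P : ℝ) (hM : 0 < M) (hP : 0 ≤ P) :
    ∃ C : ℝ, 0 ≤ C ∧ ∀ ε : ℝ, 0 < ε → ε ≤ 1 → ∀ p : Fin l → ℝ, ‖p‖ ≤ P →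
      A *ᵥ p - (m * ε) • p = -g → ∀ (ux : Fin l → ℝ) (b : ℝ), |b| ≤ M →
      ‖(1 + ε) • A *ᵥ ux + b • ((1 + ε) • g - (ε * (-m)) • w)‖ ≤ M * ε ^ 2 →
      ‖X *ᵥ (ux - b • p)‖ ≤ C * ε ^ 2 := by
  obtain ⟨NX, hNX, NXb⟩ := aux_mat_ex (X * Y)
  obtain ⟨NY, hNY, NYb⟩ := aux_mat_ex Y
  refine ⟨NX * (M + |m| * M * (|m| * (NY * P)) + |m| * M * P), by positivity, ?_⟩
  intro ε he he1 p hp hpe ux b hb h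
  have hpw : p + w = (m * ε) • (Y *ᵥ p) := by
    have := congrArg (fun v => Y *ᵥ v) hpe
    simp only [mulVec_sub, mulVec_smul, mulVec_mulVec, hY, one_mulVec, mulVec_neg, hw] at this
    have h2 : p = (m * ε) • (Y *ᵥ p) - w := by
      rw [eq_sub_iff_add_eq, ← eq_sub_iff_add_eq]
      rw [sub_eq_iff_eq_add] at this
      conv_lhs => rw [this]
      abel
    conv_lhs => rw [h2]
    simp
  have hAp : A *ᵥ p = (m * ε) • p - g := by
    rw [sub_eq_iff_eq_add] at hpe; rw [hpe]; abel
  set r := (1 + ε) • A *ᵥ ux + b • ((1 + ε) • g - (ε * (-m)) • w) with hr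
  have e1 : (1 + ε) • A *ᵥ (ux - b • p) =
      r - (ε * m * b) • ((m * ε) • (Y *ᵥ p)) - (ε ^ 2 * m * b) • p := by
    rw [← hpw, hr, mulVec_sub, mulVec_smul, hAp]
    ext i; simp; ring
  have hb1 : ‖(1 + ε) • A *ᵥ (ux - b • p)‖ ≤
      (M + |m| * M * (|m| * (NY * P)) + |m| * M * P) * ε ^ 2 := by
    rw [e1]
    have t1 : ‖(ε * m * b) • ((m * ε) • (Y *ᵥ p))‖ ≤ |m| * M * (|m| * (NY * P)) * ε ^ 2 := by
      rw [norm_smul, norm_smul]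
      simp only [Real.norm_eq_abs, abs_mul, abs_of_pos he]
      calc _ ≤ ε * |m| * M * (|m| * ε * (NY * P)) := by
            gcongr
            exact (NYb p).trans (by gcongr)
        _ = _ := by ring
    have t2 : ‖(ε ^ 2 * m * b) • p‖ ≤ |m| * M * P * ε ^ 2 := by
      rw [norm_smul]
      simp only [Real.norm_eq_abs, abs_mul, abs_of_pos (pow_pos he 2)]
      calc _ ≤ ε ^ 2 * |m| * M * P := by gcongr
        _ = _ := by ring
    calc _ ≤ M * ε ^ 2 + |m| * M * (|m| * (NY * P)) * ε ^ 2 + |m| * M * P * ε ^ 2 :=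
          (norm_sub_le _ _).trans (add_le_add ((norm_sub_le _ _).trans (add_le_add h t1)) t2)
      _ = _ := by ring
  have hb2 : ‖A *ᵥ (ux - b • p)‖ ≤ ‖(1 + ε) • A *ᵥ (ux - b • p)‖ := by
    rw [norm_smul, Real.norm_eq_abs, abs_of_pos (by linarith)]
    nlinarith [norm_nonneg (A *ᵥ (ux - b • p))]
  have e2 : X *ᵥ (ux - b • p) = (X * Y) *ᵥ (A *ᵥ (ux - b • p)) := by
    rw [mulVec_mulVec, Matrix.mul_assoc, hY, Matrix.mul_one]
  rw [e2]
  calc _ ≤ NX * ((M + |m| * M * (|m| * (NY * P)) + |m| * M * P) * ε ^ 2) :=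
        (NXb _).trans (by gcongr; exact hb2.trans hb1)
    _ = _ := by ring

theorem aux_alg1t {l : ℕ} (A X Y Xi : Matrix (Fin l) (Fin l) ℝ) (g w : Fin l → ℝ) (m : ℝ)
    (hXi : Xi * X = 1) (hY : Y * A = 1) (hw : Y *ᵥ g = w) (M P C1 : ℝ) (hM : 0 < M)
    (hP : 0 ≤ P) (hC1 : 0 ≤ C1) :
    ∃ C : ℝ, 0 ≤ C ∧ ∀ ε : ℝ, 0 < ε → ∀ p : Fin l → ℝ, ‖p‖ ≤ P →
      A *ᵥ p - (m * ε) • p = -g → ∀ (ux ut : Fin l → ℝ) (b : ℝ), |b| ≤ M →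
      ut + A *ᵥ ux = -b • g →
      ‖X *ᵥ (ux - b • p)‖ ≤ C1 * ε ^ 2 →
      ‖ut - (ε * m * b) • w‖ ≤ C * ε ^ 2 := by
  obtain ⟨NX, hNX, NXb⟩ := aux_mat_ex (A * Xi)
  obtain ⟨NY, hNY, NYb⟩ := aux_mat_ex Y
  refine ⟨NX * C1 + |m| * M * (|m| * (NY * P)), by positivity, ?_⟩
  intro ε he p hp hpe ux ut b hb hpde h
  have hpw : p + w = (m * ε) • (Y *ᵥ p) := by
    have := congrArg (fun v => Y *ᵥ v) hpe
    simp only [mulVec_sub, mulVec_smul, mulVec_mulVec, hY, one_mulVec, mulVec_neg, hw] at this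
    have h2 : p = (m * ε) • (Y *ᵥ p) - w := by
      rw [sub_eq_iff_eq_add] at this
      conv_lhs => rw [this]
      abel
    conv_lhs => rw [h2]
    simp
  have hAp : A *ᵥ p = (m * ε) • p - g := by
    rw [sub_eq_iff_eq_add] at hpe; rw [hpe]; abel
  have e1 : ut - (ε * m * b) • w =
      -((A * Xi) *ᵥ (X *ᵥ (ux - b • p))) - (ε * m * b) • ((m * ε) • (Y *ᵥ p)) := by
    rw [← hpw, mulVec_mulVec, Matrix.mul_assoc, hXi, Matrix.mul_one, mulVec_sub, mulVec_smul, hAp,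
      eq_sub_of_add_eq hpde]
    ext i; simp; ring
  have t1 : ‖(ε * m * b) • ((m * ε) • (Y *ᵥ p))‖ ≤ |m| * M * (|m| * (NY * P)) * ε ^ 2 := by
    rw [norm_smul, norm_smul]
    simp only [Real.norm_eq_abs, abs_mul, abs_of_pos he]
    calc _ ≤ ε * |m| * M * (|m| * ε * (NY * P)) := by
          gcongr
          exact (NYb p).trans (by gcongr)
      _ = _ := by ring
  have t2 : ‖-((A * Xi) *ᵥ (X *ᵥ (ux - b • p)))‖ ≤ NX * (C1 * ε ^ 2) := by
    rw [norm_neg]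
    exact (NXb _).trans (by gcongr)
  rw [e1]
  calc _ ≤ _ := (norm_sub_le _ _).trans (add_le_add t2 t1)
    _ = _ := by ring

theorem aux_p {l : ℕ} (A X : Matrix (Fin l) (Fin l) ℝ) (lam g : Fin l → ℝ) (δ m : ℝ)
    (hδ : 0 < δ) (hX : IsUnit X) (hA : A = X⁻¹ * Matrix.diagonal lam * X)
    (hlam : ∀ i : Fin l, δ ≤ |lam i|) :
    ∃ P : ℝ, 0 ≤ P ∧ ∀ ε : ℝ, 0 < ε → ε * |m| ≤ δ / 2 → ∃ p : Fin l → ℝ, ‖p‖ ≤ P ∧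
      A *ᵥ p - (m * ε) • p = -g := by
  obtain ⟨NX, hNX, NXb⟩ := aux_mat_ex X⁻¹
  have hXX : X * X⁻¹ = 1 := mul_nonsing_inv X ((isUnit_iff_isUnit_det X).1 hX)
  have hXX' : X⁻¹ * X = 1 := nonsing_inv_mul X ((isUnit_iff_isUnit_det X).1 hX)
  refine ⟨NX * (‖X *ᵥ g‖ * (2 / δ)), by positivity, fun ε he hε => ?_⟩
  have hlow : ∀ i, δ / 2 ≤ |lam i - m * ε| := by
    intro i
    have h1 := abs_sub_abs_le_abs_sub (lam i) (m * ε)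
    have h2 : |m * ε| = ε * |m| := by rw [abs_mul, abs_of_pos he, mul_comm]
    have := hlam i
    linarith
  set q : Fin l → ℝ := fun i => -((X *ᵥ g) i / (lam i - m * ε)) with hq
  have hqb : ‖q‖ ≤ ‖X *ᵥ g‖ * (2 / δ) := by
    rw [pi_norm_le_iff_of_nonneg (by positivity)]
    intro i
    rw [hq, norm_neg, norm_div, div_eq_mul_inv]
    have h1 := norm_le_pi_norm (X *ᵥ g) i
    have h2 : ‖lam i - m * ε‖⁻¹ ≤ 2 / δ := by
      rw [show 2 / δ = (δ / 2)⁻¹ by rw [inv_div]]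
      exact inv_anti₀ (by positivity) (hlow i)
    gcongr
  refine ⟨X⁻¹ *ᵥ q, (NXb q).trans (by gcongr), ?_⟩
  have e : diagonal lam *ᵥ q - (m * ε) • q = -(X *ᵥ g) := by
    ext i
    have : lam i - m * ε ≠ 0 := by
      intro h0
      have := hlow i
      rw [h0, abs_zero] at this
      linarith
    simp only [Pi.sub_apply, mulVec_diagonal, Pi.smul_apply, smul_eq_mul, Pi.neg_apply, hq]
    field_simp
    ring
  have e2 := congrArg (fun v => X⁻¹ *ᵥ v) e
  simp only [mulVec_sub, mulVec_smul, mulVec_neg, mulVec_mulVec, hXX', one_mulVec] at e2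
  rw [hA, mulVec_mulVec, Matrix.mul_assoc, hXX, Matrix.mul_one]
  exact e2

theorem aux_mulVecK {l : ℕ} (P : Matrix (Fin l) (Fin l) ℝ) (a b v : Fin l → ℝ) (k e : ℝ) :
    Matrix.fromBlocks P (Matrix.of fun i (_ : Unit) => a i) (Matrix.of fun (_ : Unit) j => b j)
      (Matrix.of fun _ _ => k) *ᵥ (Sum.elim v fun _ => e) =
    Sum.elim (P *ᵥ v + e • a) (fun _ => b ⬝ᵥ v + k * e) := by
  rw [fromBlocks_mulVec]
  ext i
  rcases i with i | i
  · simp [mulVec, dotProduct, mul_comm]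
  · simp [mulVec, dotProduct]

theorem aux_mu {l : ℕ} (g c w β : Fin l → ℝ) (A P : Matrix (Fin l) (Fin l) ℝ) (a : Fin l → ℝ)
    (hw : A *ᵥ w = g) (d : Fin l → ℝ) (ε θ μ M : ℝ) (hε : 0 < ε) (hM : 0 < M)
    (hβ : ∀ i, |β i| ≤ M) (hθ : |θ| ≤ M) (hμ : |μ| ≤ M)
    (h : Matrix.fromBlocks P (Matrix.of fun i (_ : Unit) => a i)
          (Matrix.of fun (_ : Unit) j => ε * β j) (Matrix.of fun _ _ => 1 + ε * θ) *
        Matrix.fromBlocks A (Matrix.of fun i _ => g i) (Matrix.of fun _ j => ε * c j) 0 =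
        Matrix.diagonal (Sum.elim d fun _ => ε * μ) *
        Matrix.fromBlocks P (Matrix.of fun i (_ : Unit) => a i)
          (Matrix.of fun (_ : Unit) j => ε * β j) (Matrix.of fun _ _ => 1 + ε * θ)) :
    |μ - (-(c ⬝ᵥ w))| ≤ (M * (l * M * ‖w‖) + M * (M + |(-(c ⬝ᵥ w))|)) * ε := by
  have h1 := congrFun (congrArg (fun Q => Q *ᵥ (Sum.elim w fun _ => (-1:ℝ))) h) (Sum.inr ())
  have h0 : (0 : Matrix Unit Unit ℝ) = Matrix.of fun _ _ => (0:ℝ) := rfl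
  rw [h0] at h1
  simp only [← mulVec_mulVec] at h1
  rw [aux_mulVecK A, aux_mulVecK P, mulVec_diagonal, aux_mulVecK P] at h1
  simp only [Sum.elim_inr] at h1
  have hz : A *ᵥ w + (-1:ℝ) • g = 0 := by rw [hw]; simp
  have s1 : ∀ v u : Fin l → ℝ, (fun j => ε * v j) ⬝ᵥ u = ε * (v ⬝ᵥ u) := by
    intro v u
    rw [← smul_eq_mul, ← smul_dotProduct]; rfl
  rw [hz, dotProduct_zero, s1, s1] at h1
  set m := -(c ⬝ᵥ w) with hm
  have hcw : c ⬝ᵥ w = -m := by rw [hm]; ring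
  rw [hcw] at h1
  have h2 : μ - m = ε * (μ * (β ⬝ᵥ w) - θ * (μ - m)) := by
    have : ε * (μ - m) = ε * (ε * (μ * (β ⬝ᵥ w) - θ * (μ - m))) := by linarith
    exact mul_left_cancel₀ hε.ne' this
  rw [h2, abs_mul, abs_of_pos hε, mul_comm]
  have hb := aux_dot β w M hβ
  gcongr
  refine (abs_sub _ _).trans ?_
  rw [abs_mul, abs_mul]
  have := abs_sub μ m
  gcongr
  linarith

/-- Second order accuracy of the corrected slow equation (Lemma 2): under the
eigenvalue-perturbation decomposition `C^ε = (K^ε)⁻¹ D^ε K^ε` with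
perturbation quantities bounded by `M`, if `(U,B)` is a bounded `C²` solution
of `U_t + A U_x = −g B_x`, `B_t + ε cᵀ U_x = 0` on `ℝ × [0, T₀/ε]`,
`U¹` is a bounded `C¹` solution of the modified fast dynamics
`U¹_t + A U¹_x = −g ∂_x B⁰(x,t)` with `B⁰(x,t) = B₀(x − λ_B⁰ ε t)`, and
`B̂¹` is a `C¹` solution of
`B̂¹_t − ε cᵀ A⁻¹ g B̂¹_x − ε cᵀ A⁻¹ U¹_t = 0` with `B̂¹(·,0) = B₀`, then
under the initial conditions (1)–(4) one has `|B − B̂¹| ≤ C ε²` on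
`ℝ × [0, T₀/ε]`. -/
theorem stmt_2 (l : ℕ) (A X : Matrix (Fin l) (Fin l) ℝ) (lam : Fin l → ℝ)
    (g c : Fin l → ℝ) (δ : ℝ) (hδ : 0 < δ)
    (hX : IsUnit X) (hA : A = X⁻¹ * Matrix.diagonal lam * X)
    (hdistinct : ∀ i j : Fin l, i ≠ j → lam i ≠ lam j)
    (hlam : ∀ i : Fin l, δ ≤ |lam i|)
    (M T₀ : ℝ) (hM : 0 < M) (hT₀ : 0 < T₀) :
    ∃ C > 0, ∃ ε₀ > 0, ∀ ε : ℝ, 0 < ε → ε ≤ ε₀ →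
      ∀ (Xhat : Matrix (Fin l) (Fin l) ℝ) (αhat βhat lamhat : Fin l → ℝ)
        (θhat μ : ℝ) (Kmat Dmat : Matrix (Fin l ⊕ Unit) (Fin l ⊕ Unit) ℝ),
        -- the perturbed eigenvector and eigenvalue matrices K^ε and D^ε
        Kmat = Matrix.fromBlocks (X + ε • Xhat)
            (Matrix.of fun i _ =>
              (Matrix.diagonal lam)⁻¹.mulVec (X.mulVec g) i + ε * αhat i)
            (Matrix.of fun _ j => ε * βhat j)
            (Matrix.of fun _ _ => 1 + ε * θhat) →
        Dmat = Matrix.fromBlocks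
            (Matrix.diagonal lam + ε • Matrix.diagonal lamhat) 0 0
            (Matrix.of fun _ _ => ε * μ) →
        IsUnit Kmat →
        -- the exact similarity C^ε = (K^ε)⁻¹ D^ε K^ε
        Matrix.fromBlocks A (Matrix.of fun i _ => g i)
            (Matrix.of fun _ j => ε * c j) 0 = Kmat⁻¹ * Dmat * Kmat →
        -- the perturbation quantities and (K^ε)⁻¹ are bounded by M
        (∀ i j, |Xhat i j| ≤ M) → (∀ i, |αhat i| ≤ M) → (∀ i, |βhat i| ≤ M) →
        (∀ i, |lamhat i| ≤ M) → |θhat| ≤ M → |μ| ≤ M →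
        (∀ i j, |Kmat⁻¹ i j| ≤ M) →
        ∀ (U : ℝ → ℝ → Fin l → ℝ) (B : ℝ → ℝ → ℝ)
          (Ux Ut Uxx Uxt Utt : ℝ → ℝ → Fin l → ℝ)
          (Bx Bt Bxx Bxt Btt : ℝ → ℝ → ℝ)
          (U1 U1x U1t : ℝ → ℝ → Fin l → ℝ)
          (B1 B1x B1t : ℝ → ℝ → ℝ),
          -- (U, B) is a C² classical solution on ℝ × [0, T₀/ε]
          (∀ x : ℝ, ∀ t ∈ Icc (0 : ℝ) (T₀ / ε),
            HasDerivAt (fun x' => U x' t) (Ux x t) x ∧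
            HasDerivWithinAt (fun t' => U x t') (Ut x t) (Icc 0 (T₀ / ε)) t ∧
            HasDerivAt (fun x' => B x' t) (Bx x t) x ∧
            HasDerivWithinAt (fun t' => B x t') (Bt x t) (Icc 0 (T₀ / ε)) t) →
          (∀ x : ℝ, ∀ t ∈ Icc (0 : ℝ) (T₀ / ε),
            HasDerivAt (fun x' => Ux x' t) (Uxx x t) x ∧
            HasDerivWithinAt (fun t' => Ux x t') (Uxt x t) (Icc 0 (T₀ / ε)) t ∧
            HasDerivWithinAt (fun t' => Ut x t') (Utt x t) (Icc 0 (T₀ / ε)) t ∧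
            HasDerivAt (fun x' => Bx x' t) (Bxx x t) x ∧
            HasDerivWithinAt (fun t' => Bx x t') (Bxt x t) (Icc 0 (T₀ / ε)) t ∧
            HasDerivWithinAt (fun t' => Bt x t') (Btt x t) (Icc 0 (T₀ / ε)) t) →
          -- joint C² regularity of the solution on ℝ × [0, T₀/ε]
          ContDiffOn ℝ 2 (fun p : ℝ × ℝ => U p.1 p.2)
            (univ ×ˢ Icc (0:ℝ) (T₀ / ε)) →
          ContDiffOn ℝ 2 (fun p : ℝ × ℝ => B p.1 p.2)
            (univ ×ˢ Icc (0:ℝ) (T₀ / ε)) →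
          -- boundedness of the solution
          (∃ K : ℝ, ∀ x : ℝ, ∀ t ∈ Icc (0 : ℝ) (T₀ / ε),
            ‖U x t‖ ≤ K ∧ |B x t| ≤ K) →
          -- all partial derivatives up to order two bounded by M
          (∀ x : ℝ, ∀ t ∈ Icc (0 : ℝ) (T₀ / ε),
            ‖Ux x t‖ ≤ M ∧ ‖Ut x t‖ ≤ M ∧ ‖Uxx x t‖ ≤ M ∧ ‖Uxt x t‖ ≤ M ∧
            ‖Utt x t‖ ≤ M ∧ |Bx x t| ≤ M ∧ |Bt x t| ≤ M ∧ |Bxx x t| ≤ M ∧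
            |Bxt x t| ≤ M ∧ |Btt x t| ≤ M) →
          -- the linear hyperbolic system
          (∀ x : ℝ, ∀ t ∈ Icc (0 : ℝ) (T₀ / ε),
            Ut x t + A.mulVec (Ux x t) = -(Bx x t) • g ∧
            Bt x t + ε * (c ⬝ᵥ Ux x t) = 0) →
          -- U¹ is a bounded C¹ solution of the modified fast dynamics,
          -- with first derivatives bounded by M
          (∀ x : ℝ, ∀ t ∈ Icc (0 : ℝ) (T₀ / ε),
            HasDerivAt (fun x' => U1 x' t) (U1x x t) x ∧
            HasDerivWithinAt (fun t' => U1 x t') (U1t x t) (Icc 0 (T₀ / ε)) t) →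
          -- joint C¹ regularity of U¹
          ContDiffOn ℝ 1 (fun p : ℝ × ℝ => U1 p.1 p.2)
            (univ ×ˢ Icc (0:ℝ) (T₀ / ε)) →
          (∃ K : ℝ, ∀ x : ℝ, ∀ t ∈ Icc (0 : ℝ) (T₀ / ε), ‖U1 x t‖ ≤ K) →
          (∀ x : ℝ, ∀ t ∈ Icc (0 : ℝ) (T₀ / ε),
            ‖U1x x t‖ ≤ M ∧ ‖U1t x t‖ ≤ M) →
          (∀ x : ℝ, ∀ t ∈ Icc (0 : ℝ) (T₀ / ε),
            U1t x t + A.mulVec (U1x x t)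
              = -(Bx (x - -(c ⬝ᵥ A⁻¹.mulVec g) * ε * t) 0) • g) →
          -- B̂¹ is a C¹ solution of the corrected slow equation
          (∀ x : ℝ, ∀ t ∈ Icc (0 : ℝ) (T₀ / ε),
            HasDerivAt (fun x' => B1 x' t) (B1x x t) x ∧
            HasDerivWithinAt (fun t' => B1 x t') (B1t x t) (Icc 0 (T₀ / ε)) t) →
          -- joint C¹ regularity of B̂¹
          ContDiffOn ℝ 1 (fun p : ℝ × ℝ => B1 p.1 p.2)
            (univ ×ˢ Icc (0:ℝ) (T₀ / ε)) →
          (∀ x : ℝ, ∀ t ∈ Icc (0 : ℝ) (T₀ / ε),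
            B1t x t - ε * (c ⬝ᵥ A⁻¹.mulVec g) * B1x x t
              - ε * (c ⬝ᵥ A⁻¹.mulVec (U1t x t)) = 0) →
          (∀ x : ℝ, B1 x 0 = B x 0) →
          -- initial condition (1)
          (∀ x : ℝ,
            ‖(A + ε • (X⁻¹ * Matrix.diagonal lam * Xhat)).mulVec (Ux x 0)
              + Bx x 0 • (g + ε • (X⁻¹ * Matrix.diagonal lam).mulVec αhat)‖
              ≤ M * ε ^ 2) →
          -- initial condition (2)
          (∀ x : ℝ, ‖A.mulVec (Uxx x 0) + Bxx x 0 • g‖ ≤ M * ε) →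
          -- initial condition (3)
          (∀ x : ℝ,
            ‖(1 + ε) • A.mulVec (U1x x 0)
              + Bx x 0 • ((1 + ε) • g
                  - (ε * (c ⬝ᵥ A⁻¹.mulVec g)) • A⁻¹.mulVec g)‖ ≤ M * ε ^ 2) →
          -- initial condition (4): B₀ = B(·,0) ∈ W^{2,∞}(ℝ) with norm ≤ M
          (∀ x : ℝ, |B x 0| ≤ M ∧ |Bx x 0| ≤ M ∧ |Bxx x 0| ≤ M) →
          ∀ x : ℝ, ∀ t ∈ Icc (0 : ℝ) (T₀ / ε),
            |B x t - B1 x t| ≤ C * ε ^ 2 := by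
  have hlam0 : ∀ i, lam i ≠ 0 := fun i h => by
    have := hlam i
    rw [h, abs_zero] at this
    linarith
  have hXd := (isUnit_iff_isUnit_det X).1 hX
  have hXX : X * X⁻¹ = 1 := mul_nonsing_inv X hXd
  have hXX' : X⁻¹ * X = 1 := nonsing_inv_mul X hXd
  have hLd : IsUnit (Matrix.diagonal lam).det := by
    rw [det_diagonal]
    exact (Finset.prod_ne_zero_iff.2 fun i _ => hlam0 i).isUnit
  have hL : (Matrix.diagonal lam)⁻¹ * Matrix.diagonal lam = 1 := nonsing_inv_mul _ hLd
  have hAd : IsUnit A.det := by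
    rw [← isUnit_iff_isUnit_det, hA]
    exact ((isUnit_nonsing_inv_iff.2 hX).mul ((isUnit_iff_isUnit_det _).2 hLd)).mul hX
  have hY : A⁻¹ * A = 1 := nonsing_inv_mul A hAd
  have hXA : X * A = Matrix.diagonal lam * X := by
    rw [hA, ← Matrix.mul_assoc, ← Matrix.mul_assoc, hXX, Matrix.one_mul]
  obtain ⟨w, hw⟩ : ∃ w, A⁻¹ *ᵥ g = w := ⟨_, rfl⟩
  have hAw : A *ᵥ w = g := by
    rw [← hw, mulVec_mulVec, mul_nonsing_inv A hAd, one_mulVec]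
  have hh : (Matrix.diagonal lam)⁻¹ *ᵥ (X *ᵥ g) = X *ᵥ w := by
    rw [← hAw, mulVec_mulVec w X A, hXA, mulVec_mulVec, ← Matrix.mul_assoc, hL, Matrix.one_mul]
  obtain ⟨m, hm⟩ : ∃ m, -(c ⬝ᵥ w) = m := ⟨_, rfl⟩
  have hcw : c ⬝ᵥ w = -m := by rw [← hm]; ring
  obtain ⟨C1, hC1, bC1⟩ := aux_algU0 A X (Matrix.diagonal lam) (Matrix.diagonal lam)⁻¹ g w hX hA hL
    hAw M hM
  obtain ⟨C3, hC3, bC3⟩ := aux_algU A X A⁻¹ X⁻¹ g c w hXX' hY hw M ((‖lam‖ + M) * C1) hM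
    (by positivity)
  obtain ⟨P, hP, bP⟩ := aux_p A X lam g δ m hδ hX hA hlam
  obtain ⟨C4, hC4, bC4⟩ := aux_alg1 A X A⁻¹ g w m hY hw M P hM hP
  obtain ⟨C5, hC5, bC5⟩ := aux_alg1t A X A⁻¹ X⁻¹ g w m hXX' hY hw M P C4 hM hP hC4
  obtain ⟨Nc, hNc, Ncb⟩ := aux_dot_ex c
  obtain ⟨NY, hNY, NYb⟩ := aux_mat_ex A⁻¹
  obtain ⟨D6, hD6⟩ : ∃ D6, D6 = M * (l * M * ‖w‖) + M * (M + |m|) := ⟨_, rfl⟩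
  have hD6p : 0 ≤ D6 := by rw [hD6]; positivity
  obtain ⟨D7, hD7⟩ : ∃ D7, D7 = 2 * (l * M * M) + 2 * (M * M) + M * (D6 * T₀) := ⟨_, rfl⟩
  have hD7p : 0 ≤ D7 := by rw [hD7]; positivity
  obtain ⟨D8, hD8⟩ : ∃ D8, D8 = C3 + C5 + |m| * D7 * ‖w‖ := ⟨_, rfl⟩
  have hD8p : 0 ≤ D8 := by rw [hD8]; positivity
  refine ⟨Nc * (NY * D8) * T₀ + 1, by positivity, min 1 (δ / (2 * (|m| + 1))), by positivity, ?_⟩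
  intro ε he he0 Xhat αhat βhat lamhat θhat μ Kmat Dmat hK hD hKu hsim hXh hαh hβh hlh hθ hμ _
    U B Ux Ut Uxx Uxt Utt Bx Bt Bxx Bxt Btt U1 U1x U1t B1 B1x B1t hder hder2 hUC hBC _ hbd hpde
    hder1 hU1C _ hbd1 hpde1 hderB1 hB1C hpdeB1 hinit hc1 _ hc3 hc4 x t ht
  have he1 : ε ≤ 1 := he0.trans (min_le_left _ _)
  have hem : ε * |m| ≤ δ / 2 := by
    have h1 : ε ≤ δ / (2 * (|m| + 1)) := he0.trans (min_le_right _ _)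
    rw [le_div_iff₀ (by positivity)] at h1
    nlinarith [abs_nonneg m]
  have hT : 0 < T₀ / ε := by positivity
  have h0T : (0:ℝ) ∈ Icc (0:ℝ) (T₀ / ε) := ⟨le_rfl, hT.le⟩
  simp only [hw, hcw] at hpde1 hpdeB1 hc3
  simp only [neg_neg] at hpde1
  rw [hh] at hK
  -- similarity
  have hDd : Dmat = Matrix.diagonal (Sum.elim (fun i => lam i + ε * lamhat i) fun _ => ε * μ) := by
    rw [hD]
    ext i j
    rcases i with i | i <;> rcases j with j | j <;>
      simp [Matrix.diagonal_apply]
    split_ifs <;> simp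
  have hKC : Kmat * Matrix.fromBlocks A (Matrix.of fun i _ => g i)
            (Matrix.of fun _ j => ε * c j) 0 = Dmat * Kmat := by
    rw [hsim, ← Matrix.mul_assoc, ← Matrix.mul_assoc,
      mul_nonsing_inv _ ((isUnit_iff_isUnit_det _).1 hKu), Matrix.one_mul]
  rw [hDd] at hKC
  have hmu : |μ - m| ≤ D6 * ε := by
    have := aux_mu g c w βhat A (X + ε • Xhat) (fun i => (X *ᵥ w) i + ε * αhat i) hAw
      (fun i => lam i + ε * lamhat i) ε θhat μ M he hM hβh hθ hμ (by rw [hK] at hKC; exact hKC)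
    rw [hm] at this
    rw [hD6]; exact this
  have hKv : ∀ (v : Fin l → ℝ) (e : ℝ), Kmat *ᵥ (Sum.elim v fun _ => e) =
      Sum.elim ((X + ε • Xhat) *ᵥ v + e • (X *ᵥ w + ε • αhat))
        (fun _ => ε * (βhat ⬝ᵥ v) + (1 + ε * θhat) * e) := by
    intro v e
    rw [hK, aux_mulVecK]
    have s1 : (fun j => ε * βhat j) ⬝ᵥ v = ε * (βhat ⬝ᵥ v) := by
      rw [← smul_eq_mul, ← smul_dotProduct]; rfl
    rw [s1]; rfl
  have hdU := hUC.differentiableOn (by norm_num)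
  have hdB := hBC.differentiableOn (by norm_num)
  have hdU1 := hU1C.differentiableOn (by norm_num)
  have hdB1 := hB1C.differentiableOn (by norm_num)
  -- the full system
  have hsys := aux_system hT (fun x t => Sum.elim (U x t) fun _ : Unit => B x t)
    (fun x t => Sum.elim (Ux x t) fun _ : Unit => Bx x t)
    (fun x t => Sum.elim (Ut x t) fun _ : Unit => Bt x t) Kmat _ _ hKC
    (by
      rw [differentiableOn_pi] at hdU ⊢
      rintro (i | i)
      · exact hdU i
      · exact hdB)
    (by
      intro x t h
      rw [hasDerivAt_pi]
      rintro (i | i)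
      · exact hasDerivAt_pi.1 (hder x t h).1 i
      · exact (hder x t h).2.2.1)
    (by
      intro x t h
      rw [hasDerivWithinAt_pi]
      rintro (i | i)
      · exact hasDerivWithinAt_pi.1 (hder x t h).2.1 i
      · exact (hder x t h).2.2.2)
    (by
      intro x t h
      have h0 : (0 : Matrix Unit Unit ℝ) = Matrix.of fun _ _ => (0:ℝ) := rfl
      obtain ⟨h1, h2⟩ := hpde x t h
      have s1 : (fun j => ε * c j) ⬝ᵥ Ux x t = ε * (c ⬝ᵥ Ux x t) := by
        rw [← smul_eq_mul, ← smul_dotProduct]; rfl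
      rw [h0, aux_mulVecK, s1]
      ext i
      rcases i with i | i
      · have := congrFun h1 i
        simp at this ⊢
        linarith
      · simp; linarith)
  simp only [hKv] at hsys
  -- U_t
  have hV0 : ∀ x, ‖(X + ε • Xhat) *ᵥ Ux x 0 + Bx x 0 • (X *ᵥ w + ε • αhat)‖ ≤ C1 * ε ^ 2 :=
    fun x => bC1 ε he Xhat αhat _ _ (hc1 x)
  have hUt : ∀ x, ∀ t ∈ Icc (0:ℝ) (T₀ / ε), ‖Ut x t - (ε * m * Bx x t) • w‖ ≤ C3 * ε ^ 2 := by
    intro x t h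
    obtain ⟨b1, b2, -⟩ := hbd x t h
    obtain ⟨p1, p2⟩ := hpde x t h
    have := bC3 ε he he1 Xhat αhat hXh hαh (Ux x t) (Ut x t) (Bx x t) (Bt x t) b1 b2 p1 p2 ?_
    · rw [hm] at this; exact this
    rw [pi_norm_le_iff_of_nonneg (by positivity)]
    intro i
    obtain ⟨q1, q2⟩ := hsys (Sum.inl i) x t h
    simp only [Sum.elim_inl] at q1 q2
    rw [q1, q2, norm_neg, norm_mul, mul_assoc]
    have hb := (norm_le_pi_norm _ i).trans (hV0 (x - (lam i + ε * lamhat i) * t))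
    have hl : ‖lam i + ε * lamhat i‖ ≤ ‖lam‖ + M := by
      refine (norm_add_le _ _).trans (add_le_add (norm_le_pi_norm lam i) ?_)
      rw [norm_mul, Real.norm_eq_abs, Real.norm_eq_abs, abs_of_pos he]
      have := hlh i
      nlinarith [abs_nonneg (lamhat i)]
    gcongr
  -- B_x
  have hBx : ∀ x, ∀ t ∈ Icc (0:ℝ) (T₀ / ε), |Bx x t - Bx (x - m * ε * t) 0| ≤ D7 * ε := by
    intro x t h
    obtain ⟨q1, q2⟩ := hsys (Sum.inr ()) x t h
    simp only [Sum.elim_inr] at q2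
    set y := x - ε * μ * t with hy
    have d1 := (aux_dot βhat (Ux x t) M hβh).trans
      (mul_le_mul_of_nonneg_left (hbd x t h).1 (by positivity))
    have d2 := (aux_dot βhat (Ux y 0) M hβh).trans
      (mul_le_mul_of_nonneg_left (hbd y 0 h0T).1 (by positivity))
    have d3 : |Bx x t| ≤ M := (hbd x t h).2.2.2.2.2.1
    have d4 : |Bx y 0| ≤ M := (hbd y 0 h0T).2.2.2.2.2.1
    have f1 : |Bx x t - Bx y 0| ≤ (2 * (l * M * M) + 2 * (M * M)) * ε := by
      have : Bx x t - Bx y 0 =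
          ((βhat ⬝ᵥ Ux y 0 - βhat ⬝ᵥ Ux x t) + θhat * (Bx y 0 - Bx x t)) * ε := by linarith
      rw [this, abs_mul, abs_of_pos he]
      gcongr
      refine (abs_add_le _ _).trans ?_
      rw [abs_mul]
      have e1 := abs_sub (βhat ⬝ᵥ Ux y 0) (βhat ⬝ᵥ Ux x t)
      have e2 : |θhat| * |Bx y 0 - Bx x t| ≤ M * (2 * M) := by
        have := abs_sub (Bx y 0) (Bx x t)
        gcongr
        linarith
      linarith
    have f2 : |Bx y 0 - Bx (x - m * ε * t) 0| ≤ M * (D6 * T₀) * ε := by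
      have := Convex.norm_image_sub_le_of_norm_hasDerivWithin_le (𝕜 := ℝ)
        (f := fun z => Bx z 0) (f' := fun z => Bxx z 0) (C := M) (s := univ)
        (x := x - m * ε * t) (y := y)
        (fun z _ => ((hder2 z 0 h0T).2.2.2.1).hasDerivWithinAt)
        (fun z _ => (hc4 z).2.2) convex_univ (mem_univ _) (mem_univ _)
      refine this.trans ?_
      have e1 : y - (x - m * ε * t) = (m - μ) * (ε * t) := by rw [hy]; ring
      have e2 : ε * t ≤ T₀ := by
        have := h.2
        rw [le_div_iff₀ he] at this
        linarith
      have e3 : 0 ≤ ε * t := mul_nonneg he.le h.1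
      rw [e1, norm_mul, Real.norm_eq_abs, Real.norm_eq_abs, abs_of_nonneg e3, abs_sub_comm]
      calc M * (|μ - m| * (ε * t)) ≤ M * ((D6 * ε) * T₀) := by gcongr
        _ = _ := by ring
    have := abs_sub_le (Bx x t) (Bx y 0) (Bx (x - m * ε * t) 0)
    rw [hD7]
    linarith
  -- U1
  obtain ⟨p, hp, hpe⟩ := bP ε he hem
  have hshift : ∀ x t, HasDerivAt (fun z => B z 0) (Bx (x - m * ε * t) 0) (x - m * ε * t) :=
    fun x t => (hder _ 0 h0T).2.2.1
  have hsys1 := aux_system hT (fun x t => U1 x t - B (x - m * ε * t) 0 • p)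
    (fun x t => U1x x t - Bx (x - m * ε * t) 0 • p)
    (fun x t => U1t x t - (Bx (x - m * ε * t) 0 * (-(m * ε))) • p) X A lam hXA
    (by
      refine hdU1.sub (DifferentiableOn.smul_const ?_ p)
      have hB0 : Differentiable ℝ (fun z => B z 0) :=
        fun z => (hder z 0 h0T).2.2.1.differentiableAt
      have : Differentiable ℝ (fun q : ℝ × ℝ => B (q.1 - m * ε * q.2) 0) :=
        hB0.comp (f := fun q : ℝ × ℝ => q.1 - m * ε * q.2) (by fun_prop)
      exact this.differentiableOn)
    (by
      intro x t h
      refine (hder1 x t h).1.sub (HasDerivAt.smul_const ?_ p)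
      exact (hshift x t).comp_sub_const x (m * ε * t))
    (by
      intro x t h
      refine (hder1 x t h).2.sub (HasDerivWithinAt.smul_const ?_ p)
      have h1 : HasDerivAt (fun t' : ℝ => x - m * ε * t') (-(m * ε)) t := by
        simpa using ((hasDerivAt_id t).const_mul (m * ε)).const_sub x
      exact ((hshift x t).comp t h1).hasDerivWithinAt)
    (by
      intro x t h
      have h1 := hpde1 x t h
      rw [mulVec_sub, mulVec_smul]
      rw [sub_eq_iff_eq_add] at hpe
      rw [hpe, eq_sub_of_add_eq h1]
      ext i
      simp
      ring)
  have hU1t : ∀ x, ∀ t ∈ Icc (0:ℝ) (T₀ / ε),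
      ‖U1t x t - (ε * m * Bx (x - m * ε * t) 0) • w‖ ≤ C5 * ε ^ 2 := by
    intro x t h
    refine bC5 ε he p hp hpe (U1x x t) _ _ (hc4 _).2.1 (hpde1 x t h) ?_
    rw [pi_norm_le_iff_of_nonneg (by positivity)]
    intro i
    rw [(hsys1 i x t h).2]
    refine (norm_le_pi_norm _ i).trans ?_
    simp only [mul_zero, sub_zero]
    exact bC4 ε he he1 p hp hpe _ _ (hc4 _).2.1 (hc3 _)
  have hdiff : ∀ x, ∀ t ∈ Icc (0:ℝ) (T₀ / ε), ‖Ut x t - U1t x t‖ ≤ D8 * ε ^ 2 := by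
    intro x t h
    have e : Ut x t - U1t x t = (Ut x t - (ε * m * Bx x t) • w)
        - (U1t x t - (ε * m * Bx (x - m * ε * t) 0) • w)
        + (ε * m * (Bx x t - Bx (x - m * ε * t) 0)) • w := by
      ext i; simp; ring
    rw [e]
    have h3 : ‖(ε * m * (Bx x t - Bx (x - m * ε * t) 0)) • w‖ ≤ |m| * D7 * ‖w‖ * ε ^ 2 := by
      rw [norm_smul, Real.norm_eq_abs, abs_mul, abs_mul, abs_of_pos he]
      calc _ ≤ ε * |m| * (D7 * ε) * ‖w‖ := by
            have := hBx x t h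
            gcongr
        _ = _ := by ring
    calc _ ≤ C3 * ε ^ 2 + C5 * ε ^ 2 + |m| * D7 * ‖w‖ * ε ^ 2 :=
          (norm_add_le _ _).trans (add_le_add ((norm_sub_le _ _).trans
            (add_le_add (hUt x t h) (hU1t x t h))) h3)
      _ = _ := by rw [hD8]; ring
  -- conclusion
  have hfin := aux_transport hT (fun x t => B x t - B1 x t) (fun x t => Bx x t - B1x x t)
    (fun x t => Bt x t - B1t x t) (hdB.sub hdB1)
    (fun x t h => (hder x t h).2.2.1.sub (hderB1 x t h).1)
    (fun x t h => (hder x t h).2.2.2.sub (hderB1 x t h).2) (m * ε)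
    (ε * (Nc * (NY * (D8 * ε ^ 2))))
    (by
      intro x t h
      obtain ⟨p1, p2⟩ := hpde x t h
      have hux_eq : Ux x t = -Bx x t • w - A⁻¹ *ᵥ Ut x t := by
        have : A *ᵥ Ux x t = -Bx x t • g - Ut x t := by rw [← p1]; simp
        calc Ux x t = A⁻¹ *ᵥ (A *ᵥ Ux x t) := by rw [mulVec_mulVec, hY, one_mulVec]
          _ = _ := by rw [this, mulVec_sub, mulVec_smul, hw]
      have hc : c ⬝ᵥ Ux x t = Bx x t * m - c ⬝ᵥ A⁻¹ *ᵥ Ut x t := by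
        conv_lhs => rw [hux_eq]
        rw [dotProduct_sub, dotProduct_smul, smul_eq_mul, hcw]
        ring
      have p3 := hpdeB1 x t h
      have e : Bt x t - B1t x t + m * ε * (Bx x t - B1x x t) =
          ε * (c ⬝ᵥ A⁻¹ *ᵥ (Ut x t - U1t x t)) := by
        rw [mulVec_sub, dotProduct_sub]
        rw [hc] at p2
        linarith
      rw [e, abs_mul, abs_of_pos he]
      have := hdiff x t h
      gcongr
      refine (Ncb _).trans ?_
      gcongr
      refine (NYb _).trans ?_
      gcongr)
    x t ht
  simp only [hinit, sub_self, sub_zero] at hfin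
  refine hfin.trans ?_
  have e2 : ε * t ≤ T₀ := by
    have := ht.2
    rw [le_div_iff₀ he] at this
    linarith
  calc ε * (Nc * (NY * (D8 * ε ^ 2))) * t = Nc * (NY * D8) * (ε * t) * ε ^ 2 := by ring
    _ ≤ Nc * (NY * D8) * T₀ * ε ^ 2 := by gcongr
    _ ≤ _ := by
      have := sq_nonneg ε
      linarith
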